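/- Let g be a finite-dimensional real Lie algebra, φ an alternating trilinear form on g, and 𝒩 a paired linear endomorphism of g ⊕ g* with components (N, π, σ, −N^t) satisfying 𝒩² = −Id. Then T^φ_𝒩(x,y) = 0 for all x, y ∈ g (torsion with respect to the φ-twisted double bracket) if and only if both: (i) T_N(x,y) = π((dσ + i_N φ)(x,y,·)) − N(π(φ(x,y,·))) for all x, y ∈ g; and (ii) d(Nσ)(x,y,z) + φ(x,y,z) = φ(Nx,Ny,z) + φ(Nx,y,Nz) + φ(x,Ny,Nz) + (i_N(dσ))(x,y,z) for all x, y, z ∈ g, where (Nσ)(x,y) := σ(Nx, y). -/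

import Mathlib

noncomputable section
open Module

variable {g : Type*} [LieRing g] [LieAlgebra ℝ g]

/-- coadjoint action: `(coad x γ) y = -γ ⁅x, y⁆`. -/
def coad (x : g) (γ : Dual ℝ g) : Dual ℝ g := -(γ ∘ₗ LieAlgebra.ad ℝ g x)

/-- bracket on the dual induced by a skew map `π`: `[α,β]_π = ad*_{π α} β - ad*_{π β} α`. -/
def brP (π : Dual ℝ g →ₗ[ℝ] g) (α β : Dual ℝ g) : Dual ℝ g :=
  coad (π α) β - coad (π β) α

/-- deformed bracket `[x,y]_N`. -/
def brN (N : g →ₗ[ℝ] g) (x y : g) : g := ⁅N x, y⁆ + ⁅x, N y⁆ - N ⁅x, y⁆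

/-- Nijenhuis torsion of `N`. -/
def TN (N : g →ₗ[ℝ] g) (x y : g) : g := ⁅N x, N y⁆ - N (brN N x y)

/-- `[α,β]_{Nπ}`. -/
def brNP (π : Dual ℝ g →ₗ[ℝ] g) (N : g →ₗ[ℝ] g) (α β : Dual ℝ g) : Dual ℝ g :=
  coad (N (π α)) β - coad (N (π β)) α

/-- `[α,β]_π^{N^t}`. -/
def brPNt (π : Dual ℝ g →ₗ[ℝ] g) (N : g →ₗ[ℝ] g) (α β : Dual ℝ g) : Dual ℝ g :=
  brP π (N.dualMap α) β + brP π α (N.dualMap β) - N.dualMap (brP π α β)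

/-- Magri–Morosi concomitant `C(π,N)`. -/
def MM (π : Dual ℝ g →ₗ[ℝ] g) (N : g →ₗ[ℝ] g) (α β : Dual ℝ g) : Dual ℝ g :=
  brNP π N α β - brPNt π N α β

/-- torsion of `N^t` with respect to `[·,·]_π`. -/
def TNdual (π : Dual ℝ g →ₗ[ℝ] g) (N : g →ₗ[ℝ] g) (α β : Dual ℝ g) : Dual ℝ g :=
  brP π (N.dualMap α) (N.dualMap β) - N.dualMap (brPNt π N α β)

/-- Chevalley–Eilenberg differential of a 2-form `σ`, with two arguments plugged in:
`(d2 σ x y) z = -σ ⁅x,y⁆ z + σ ⁅x,z⁆ y - σ ⁅y,z⁆ x`. -/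
def d2 (σ : g →ₗ[ℝ] Dual ℝ g) (x y : g) : Dual ℝ g :=
  -(σ ⁅x, y⁆) + (σ ∘ₗ LieAlgebra.ad ℝ g x).flip y - (σ ∘ₗ LieAlgebra.ad ℝ g y).flip x

/-- the canonical symmetric pairing on `g ⊕ g*`. -/
def pairE (e f : g × Dual ℝ g) : ℝ := e.2 f.1 + f.2 e.1

/-- a paired operator on `g ⊕ g*`. -/
def Paired (𝒩 : g × Dual ℝ g →ₗ[ℝ] g × Dual ℝ g) : Prop :=
  ∀ e f, pairE (𝒩 e) f + pairE e (𝒩 f) = 0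

/-- untwisted double bracket on `g ⊕ g*`. -/
def dbl (e f : g × Dual ℝ g) : g × Dual ℝ g :=
  (⁅e.1, f.1⁆, coad e.1 f.2 - coad f.1 e.2)

/-- the `𝒩`-deformed untwisted double bracket. -/
def dblN (𝒩 : g × Dual ℝ g →ₗ[ℝ] g × Dual ℝ g) (e f : g × Dual ℝ g) : g × Dual ℝ g :=
  dbl (𝒩 e) f + dbl e (𝒩 f) - 𝒩 (dbl e f)

/-- Courant–Nijenhuis torsion of `𝒩` (untwisted bracket). -/
def Tcal (𝒩 : g × Dual ℝ g →ₗ[ℝ] g × Dual ℝ g) (e f : g × Dual ℝ g) : g × Dual ℝ g :=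
  dbl (𝒩 e) (𝒩 f) - 𝒩 (dblN 𝒩 e f)

/-- the `φ`-twisted double bracket on `g ⊕ g*`. -/
def dblT (φ : g →ₗ[ℝ] g →ₗ[ℝ] Dual ℝ g) (e f : g × Dual ℝ g) : g × Dual ℝ g :=
  (⁅e.1, f.1⁆, coad e.1 f.2 - coad f.1 e.2 + φ e.1 f.1)

/-- the `𝒩`-deformed `φ`-twisted double bracket. -/
def dblTN (φ : g →ₗ[ℝ] g →ₗ[ℝ] Dual ℝ g) (𝒩 : g × Dual ℝ g →ₗ[ℝ] g × Dual ℝ g)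
    (e f : g × Dual ℝ g) : g × Dual ℝ g :=
  dblT φ (𝒩 e) f + dblT φ e (𝒩 f) - 𝒩 (dblT φ e f)

/-- Courant–Nijenhuis torsion of `𝒩` with respect to the `φ`-twisted bracket. -/
def TcalT (φ : g →ₗ[ℝ] g →ₗ[ℝ] Dual ℝ g) (𝒩 : g × Dual ℝ g →ₗ[ℝ] g × Dual ℝ g)
    (e f : g × Dual ℝ g) : g × Dual ℝ g :=
  dblT φ (𝒩 e) (𝒩 f) - 𝒩 (dblTN φ 𝒩 e f)

/-- a trilinear form (curried, `Dual`-valued) is alternating. -/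
def IsAlt3 (φ : g →ₗ[ℝ] g →ₗ[ℝ] Dual ℝ g) : Prop :=
  (∀ x z : g, φ x x z = 0) ∧ (∀ x y : g, φ x y y = 0)

/-- `i_N` applied to a trilinear form, with two arguments plugged in. -/
def iN3 (N : g →ₗ[ℝ] g) (φ : g →ₗ[ℝ] g →ₗ[ℝ] Dual ℝ g) (x y : g) : Dual ℝ g :=
  φ (N x) y + φ x (N y) + (φ x y) ∘ₗ N

/-- Chevalley–Eilenberg differential of a 3-form given as a plain function. -/
def d3 (F : g → g → g → ℝ) (x y z w : g) : ℝ :=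
  -F ⁅x, y⁆ z w + F ⁅x, z⁆ y w - F ⁅x, w⁆ y z - F ⁅y, z⁆ x w + F ⁅y, w⁆ x z - F ⁅z, w⁆ x y

theorem d2_apply (σ : g →ₗ[ℝ] Dual ℝ g) (x y z : g) :
    d2 σ x y z = -(σ ⁅x, y⁆ z) + σ ⁅x, z⁆ y - σ ⁅y, z⁆ x := by
  simp [d2]

theorem coad_apply (x : g) (γ : Dual ℝ g) (y : g) : coad x γ y = -γ ⁅x, y⁆ := by
  simp [coad]

/-- For a skew 2-form, `dσ` is expressed through the coadjoint action. -/
theorem d2_eq_coad {σ : g →ₗ[ℝ] Dual ℝ g} (hσ : ∀ x y, σ x y = -σ y x) (x y : g) :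
    d2 σ x y = coad x (σ y) - coad y (σ x) - σ ⁅x, y⁆ := by
  ext z
  simp only [d2_apply, LinearMap.sub_apply, coad_apply]
  rw [hσ ⁅x, z⁆ y, hσ ⁅y, z⁆ x]
  ring

/-- The two components of the twisted torsion on `g`, for an endomorphism of the form
`(N, π, σ, -Nᵗ)`. -/
theorem TcalT_inl {φ : g →ₗ[ℝ] g →ₗ[ℝ] Dual ℝ g} {N : g →ₗ[ℝ] g} {π : Dual ℝ g →ₗ[ℝ] g}
    {σ : g →ₗ[ℝ] Dual ℝ g} {𝒩 : g × Dual ℝ g →ₗ[ℝ] g × Dual ℝ g}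
    (hcomp : ∀ (x : g) (α : Dual ℝ g), 𝒩 (x, α) = (N x + π α, σ x - N.dualMap α))
    (hσ : ∀ x y, σ x y = -σ y x) (x y : g) :
    TcalT φ 𝒩 (x, 0) (y, 0) =
      (TN N x y - (π (d2 σ x y + iN3 N φ x y) - N (π (φ x y))),
        coad (N x) (σ y) - coad (N y) (σ x) + φ (N x) (N y) - σ (brN N x y) + σ (π (φ x y)) +
          N.dualMap (d2 σ x y + iN3 N φ x y)) := by
  have hdef : dblTN φ 𝒩 (x, 0) (y, 0) =
      (brN N x y - π (φ x y), d2 σ x y + iN3 N φ x y) := by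
    ext z
    · simp [dblTN, dblT, hcomp, brN, coad]
      abel
    · simp [dblTN, dblT, hcomp, d2_eq_coad hσ, iN3, coad]
      ring
  rw [TcalT, hdef, hcomp]
  ext z
  · simp [dblT, hcomp, TN]
    abel
  · simp [dblT, hcomp]
    ring

theorem twisted_torsion_on_algebra_iff [FiniteDimensional ℝ g]
    (φ : g →ₗ[ℝ] g →ₗ[ℝ] Dual ℝ g) (hφ : IsAlt3 φ)
    (N : g →ₗ[ℝ] g) (π : Dual ℝ g →ₗ[ℝ] g) (σ : g →ₗ[ℝ] Dual ℝ g)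
    (𝒩 : g × Dual ℝ g →ₗ[ℝ] g × Dual ℝ g)
    (hpair : Paired 𝒩)
    (hcomp : ∀ (x : g) (α : Dual ℝ g), 𝒩 (x, α) = (N x + π α, σ x - N.dualMap α))
    (hsq : ∀ e : g × Dual ℝ g, 𝒩 (𝒩 e) = -e) :
    (∀ x y : g, TcalT φ 𝒩 (x, (0 : Dual ℝ g)) (y, (0 : Dual ℝ g)) = 0) ↔
      ((∀ x y : g, TN N x y = π (d2 σ x y + iN3 N φ x y) - N (π (φ x y))) ∧
        (∀ x y z : g,
          d2 (σ ∘ₗ N) x y z + φ x y z =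
            φ (N x) (N y) z + φ (N x) y (N z) + φ x (N y) (N z) +
              (d2 σ (N x) y z + d2 σ x (N y) z + d2 σ x y (N z)))) := by
  have hσ : ∀ x y, σ x y = -σ y x := fun x y => by
    have h := hpair (x, 0) (y, 0)
    simp only [pairE, hcomp, map_zero, sub_zero, add_zero, LinearMap.zero_apply, zero_add] at h
    linarith
  have hσN : ∀ x y, σ (N x) y = σ x (N y) := fun x y => by
    have h := congrArg (fun e => e.2 y) (hsq (x, 0))
    simp [hcomp] at h
    linarith
  have hσπ : ∀ (α : Dual ℝ g) (z : g), σ (π α) z + α (N (N z)) = -α z := fun α z => by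
    have h := congrArg (fun e => e.2 z) (hsq (0, α))
    simp [hcomp] at h
    linarith
  have key : ∀ x y z : g,
      (coad (N x) (σ y) - coad (N y) (σ x) + φ (N x) (N y) - σ (brN N x y) + σ (π (φ x y)) +
          N.dualMap (d2 σ x y + iN3 N φ x y)) z =
        φ (N x) (N y) z + φ (N x) y (N z) + φ x (N y) (N z) +
              (d2 σ (N x) y z + d2 σ x (N y) z + d2 σ x y (N z)) -
          (d2 (σ ∘ₗ N) x y z + φ x y z) := fun x y z => by
    have h := hσπ (φ x y) z
    simp only [LinearMap.add_apply, LinearMap.sub_apply, LinearMap.dualMap_apply, coad_apply,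
      d2_apply, iN3, brN, map_add, map_sub, LinearMap.comp_apply]
    rw [hσN ⁅x, z⁆ y, hσN ⁅y, z⁆ x, hσ y ⁅N x, z⁆, hσ x ⁅N y, z⁆]
    linarith
  simp only [TcalT_inl hcomp hσ, Prod.mk_eq_zero, sub_eq_zero, forall_and, LinearMap.ext_iff, key,
    LinearMap.zero_apply]
  exact and_congr_right fun _ =>
    ⟨fun h x y z => (h x y z).symm, fun h x y z => (h x y z).symm⟩
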